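/- Let ν > −1 and let (α_{ν,n})_{n≥1} be the strictly increasing enumeration of the positive zeros of the Dini function d_ν. Then for every complex z that is not a zero of g_ν' one has the Mittag-Leffler expansion g_ν''(z)/g_ν'(z) = −∑_{n≥1} 2z/(α_{ν,n}² − z²). -/

import Mathlib

open Real Filter Set

/-- The Bessel function of the first kind of (real) order `ν`, for a complex argument,
defined by its power series (principal branch of `z ^ ν`). -/
noncomputable def besselJC (ν : ℝ) (z : ℂ) : ℂ :=
  ∑' n : ℕ, (-1 : ℂ) ^ n * z ^ (2 * (n : ℂ) + (ν : ℂ)) /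
    (2 ^ (2 * (n : ℂ) + (ν : ℂ)) * (n.factorial : ℂ) * Complex.Gamma ((n : ℂ) + ν + 1))

/-- The Dini function `d_ν(z) = (1-ν) J_ν(z) + z J_ν'(z) = J_ν(z) - z J_{ν+1}(z)`. -/
noncomputable def diniC (ν : ℝ) (z : ℂ) : ℂ :=
  besselJC ν z - z * besselJC (ν + 1) z

/-- The derivative `g_ν'` of `g_ν(z) = 2^ν Γ(ν+1) z^{1-ν} J_ν(z)`, namely
`g_ν'(z) = 2^ν Γ(ν+1) z^{-ν} d_ν(z)`. -/
noncomputable def gderivC (ν : ℝ) (z : ℂ) : ℂ :=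
  2 ^ (ν : ℂ) * Complex.Gamma ((ν : ℂ) + 1) * z ^ (-(ν : ℂ)) * diniC ν z

open Topology Metric in
/-- A holomorphic function on a disk without zeros, normalised at the centre and bounded by
`exp M`, has logarithmic derivative at most `8 M / R` on the concentric disk of radius `R / 4`. -/
theorem norm_logDeriv_le_of_norm_le_exp {h : ℂ → ℂ} {R M : ℝ} {w : ℂ} (hR : 0 < R) (hM : 0 < M)
    (hd : DifferentiableOn ℂ h (ball 0 R)) (h0 : h 0 = 1) (hne : ∀ x ∈ ball (0 : ℂ) R, h x ≠ 0)
    (hb : ∀ x ∈ ball (0 : ℂ) R, ‖h x‖ ≤ Real.exp M) (hw : ‖w‖ ≤ R / 4) :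
    ‖logDeriv h w‖ ≤ 8 * M / R := by
  have hdd : DifferentiableOn ℂ (logDeriv h) (ball 0 R) := (hd.deriv isOpen_ball).div hd hne
  obtain ⟨L, hL0, hL⟩ := hdd.isExactOn_ball.with_val_at 0 0
  have hLd : DifferentiableOn ℂ L (ball 0 R) := fun x hx =>
    (hL x hx).differentiableAt.differentiableWithinAt
  have hconst : ∀ x ∈ ball (0 : ℂ) R, h x * Complex.exp (-L x) = 1 := by
    intro x hx
    have hder : ∀ y ∈ ball (0 : ℂ) R,
        HasDerivAt (fun y => h y * Complex.exp (-L y)) 0 y := by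
      intro y hy
      have h1 := (hd.differentiableAt (isOpen_ball.mem_nhds hy)).hasDerivAt
      refine (h1.mul (hL y hy).neg.cexp).congr_deriv ?_
      rw [logDeriv_apply]
      field_simp [hne y hy]
      simp
    have := isOpen_ball.is_const_of_deriv_eq_zero (convex_ball (0 : ℂ) R).isPreconnected
      (fun y hy => (hder y hy).differentiableAt.differentiableWithinAt)
      (fun y hy => (hder y hy).deriv) hx (mem_ball_self hR)
    simpa [h0, hL0] using this
  have hre : MapsTo L (ball 0 R) {z | z.re ≤ M} := by
    intro x hx
    have h1 := congrArg norm (hconst x hx)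
    rw [norm_mul, Complex.norm_exp, Complex.neg_re, Real.exp_neg, norm_one,
      mul_inv_eq_one₀ (Real.exp_pos _).ne'] at h1
    exact Real.exp_le_exp.mp (h1 ▸ hb x hx)
  have hLw : ∀ x ∈ sphere w (R / 4), ‖L x‖ ≤ 2 * M := by
    intro x hx
    have hx2 : ‖x‖ ≤ R / 2 := by
      have := norm_le_norm_add_norm_sub' x w
      rw [mem_sphere, dist_eq_norm] at hx
      linarith
    have hxR : x ∈ ball (0 : ℂ) R := by rw [mem_ball_zero_iff]; linarith
    refine (Complex.borelCaratheodory_zero hM hLd hre hR hxR hL0).trans ?_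
    rw [div_le_iff₀ (by linarith)]
    nlinarith
  have hwR : w ∈ ball (0 : ℂ) R := by rw [mem_ball_zero_iff]; linarith
  have hsub : closedBall w (R / 4) ⊆ ball 0 R := by
    intro x hx
    rw [mem_closedBall, dist_eq_norm] at hx
    have := norm_le_norm_add_norm_sub' x w
    rw [mem_ball_zero_iff]; linarith
  have := Complex.norm_deriv_le_of_forall_mem_sphere_norm_le (by linarith : 0 < R / 4)
    ((hLd.mono (closure_ball_subset_closedBall.trans hsub)).diffContOnCl) hLw
  rw [(hL w hwR).deriv] at this
  refine this.trans (le_of_eq ?_)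
  field_simp
  norm_num

/-- Finitely many distinct nonzero zeros can be divided out of an entire function. -/
theorem exists_eq_prod_one_sub_div_mul {H : ℂ → ℂ} (hH : Differentiable ℂ H) {ι : Type*}
    {l : ι → ℂ} (hl : Function.Injective l) (hl0 : ∀ i, l i ≠ 0) (hz : ∀ i, H (l i) = 0)
    (s : Finset ι) :
    ∃ h : ℂ → ℂ, Differentiable ℂ h ∧ ∀ w, H w = (∏ i ∈ s, (1 - w / l i)) * h w := by
  classical
  induction s using Finset.induction_on with
  | empty => exact ⟨H, hH, by simp⟩
  | insert m s hm ih =>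
    obtain ⟨h, hd, he⟩ := ih
    have hzero : h (l m) = 0 := by
      have h1 := he (l m)
      rw [hz m, eq_comm, mul_eq_zero] at h1
      refine h1.resolve_left (Finset.prod_ne_zero_iff.mpr fun i hi h2 => ?_)
      rw [sub_eq_zero, eq_comm, div_eq_one_iff_eq (hl0 i)] at h2
      exact hm (hl h2 ▸ hi)
    refine ⟨fun w => -l m * dslope h (l m) w, ?_, fun w => ?_⟩
    · have := (Complex.differentiableOn_dslope (f := h) (s := univ) (c := l m) univ_mem).mpr
        hd.differentiableOn
      exact (differentiableOn_univ.mp this).const_mul _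
    · have h1 := sub_smul_dslope h (l m) w
      rw [hzero, sub_zero, smul_eq_mul] at h1
      rw [he w, Finset.prod_insert hm, ← h1]
      field_simp [hl0 m]
      ring

open Topology Metric in
/-- If the distinct positive reals `l i` are zeros of an entire function which does not vanish at
the origin, then only finitely many of them lie below any given bound. -/
theorem finite_setOf_le_of_zeros {H : ℂ → ℂ} (hH : Differentiable ℂ H) (h0 : H 0 ≠ 0) {ι : Type*}
    {l : ι → ℝ} (hl : Function.Injective l) (hpos : ∀ i, 0 < l i) (hz : ∀ i, H (l i) = 0)
    (R : ℝ) : {i | l i ≤ R}.Finite := by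
  by_contra hinf
  have hinj : Function.Injective fun i => (l i : ℂ) := Complex.ofReal_injective.comp hl
  have hinf2 : ((fun i => (l i : ℂ)) '' {i | l i ≤ R}).Infinite :=
    Set.Infinite.image hinj.injOn hinf
  obtain ⟨x, -, hx⟩ := hinf2.exists_accPt_of_subset_isCompact (isCompact_closedBall (0 : ℂ) R) (by
    rintro _ ⟨i, hi, rfl⟩
    simpa [abs_of_pos (hpos i)] using hi)
  rw [accPt_iff_frequently_nhdsNE] at hx
  have hA : AnalyticOnNhd ℂ H univ := hH.differentiableOn.analyticOnNhd isOpen_univ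
  have := hA.eqOn_zero_of_preconnected_of_frequently_eq_zero isPreconnected_univ (mem_univ x)
    (hx.mono (by rintro _ ⟨i, -, rfl⟩; exact hz i))
  exact h0 (this (mem_univ 0))

/-- The logarithmic derivative of a finite product `∏ (1 - w / l i)`. -/
theorem logDeriv_prod_one_sub_div {ι : Type*} {l : ι → ℂ} (hl0 : ∀ i, l i ≠ 0) (s : Finset ι)
    {w : ℂ} (hw : ∀ i ∈ s, l i ≠ w) :
    logDeriv (fun w => ∏ i ∈ s, (1 - w / l i)) w = -∑ i ∈ s, 1 / (l i - w) := by
  rw [logDeriv_prod (f := fun i w => 1 - w / l i), ← Finset.sum_neg_distrib]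
  · refine Finset.sum_congr rfl fun i hi => ?_
    have hd : HasDerivAt (fun w => 1 - w / l i) (-(1 / l i)) w :=
      ((hasDerivAt_id w).div_const _).const_sub 1
    have h1 : l i - w ≠ 0 := sub_ne_zero.mpr (hw i hi)
    rw [logDeriv_apply, hd.deriv]
    have h2 : 1 - w / l i = (l i - w) / l i := by field_simp [hl0 i]
    rw [h2]
    field_simp [hl0 i]
  · intro i hi h1
    rw [sub_eq_zero, eq_comm, div_eq_one_iff_eq (hl0 i)] at h1
    exact hw i hi h1.symm
  · intro i _
    fun_prop

open Topology Metric in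
/-- For an entire function of growth `exp (o (‖w‖))` with only simple positive zeros, the
logarithmic derivative is approximated by the partial sums over the zeros below `R`. -/
theorem exists_norm_logDeriv_add_sum_le {H : ℂ → ℂ} (hH : Differentiable ℂ H) (h0 : H 0 = 1)
    (hg : ∀ ε : ℝ, 0 < ε → ∃ C : ℝ, ∀ w, ‖H w‖ ≤ C * Real.exp (ε * ‖w‖)) {ι : Type*} {l : ι → ℝ}
    (hl : Function.Injective l) (hpos : ∀ i, 0 < l i)
    (hz : ∀ w, H w = 0 ↔ ∃ i, (l i : ℂ) = w) (hs : ∀ i, deriv H (l i) ≠ 0)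
    {ε : ℝ} (hε : 0 < ε) :
    ∃ R₀ : ℝ, ∀ R, R₀ ≤ R → ∀ s : Finset ι, (∀ i, i ∈ s ↔ l i ≤ R) → ∀ w, H w ≠ 0 →
      ‖w‖ ≤ R / 4 → ‖logDeriv H w + ∑ i ∈ s, 1 / ((l i : ℂ) - w)‖ ≤ ε := by
  obtain ⟨C, hC⟩ := hg (ε / 32) (by positivity)
  have hC1 : 1 ≤ C := by simpa [h0] using hC 0
  have hlog : 0 ≤ Real.log C := Real.log_nonneg hC1
  refine ⟨16 * Real.log C / ε + 1, fun R hR s hsR w hw hwR => ?_⟩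
  have hR0 : 0 < R := by
    have : 0 ≤ 16 * Real.log C / ε := by positivity
    linarith
  have hl0 : ∀ i, (l i : ℂ) ≠ 0 := fun i => by exact_mod_cast (hpos i).ne'
  have hz' : ∀ i, H (l i) = 0 := fun i => (hz _).mpr ⟨i, rfl⟩
  obtain ⟨h, hd, he⟩ := exists_eq_prod_one_sub_div_mul hH
    (l := fun i => (l i : ℂ)) (Complex.ofReal_injective.comp hl) hl0 hz' s
  have hPd : Differentiable ℂ fun w : ℂ => ∏ i ∈ s, (1 - w / (l i : ℂ)) := by fun_prop
  have hh0 : h 0 = 1 := by simpa [h0] using (he 0).symm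
  have hne : ∀ x ∈ ball (0 : ℂ) R, h x ≠ 0 := by
    intro x hx hx0
    obtain ⟨i, rfl⟩ := (hz x).mp (by rw [he, hx0, mul_zero])
    have hi : i ∈ s := by
      rw [hsR]
      rw [mem_ball_zero_iff, Complex.norm_real, Real.norm_of_nonneg (hpos i).le] at hx
      exact hx.le
    refine hs i ?_
    have hP : ∏ j ∈ s, (1 - (l i : ℂ) / (l j : ℂ)) = 0 :=
      Finset.prod_eq_zero hi (by rw [div_self (hl0 i), sub_self])
    rw [show H = fun w => (∏ i ∈ s, (1 - w / (l i : ℂ))) * h w from funext he,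
      deriv_fun_mul (hPd _) (hd _), hP, hx0, mul_zero, zero_mul, add_zero]
  set M : ℝ := Real.log C + ε / 32 * (2 * R) with hM
  have hM0 : 0 < M := by positivity
  have hb : ∀ x ∈ ball (0 : ℂ) R, ‖h x‖ ≤ Real.exp M := by
    intro x hx
    refine Complex.norm_le_of_forall_mem_frontier_norm_le (U := ball (0 : ℂ) (2 * R))
      isBounded_ball hd.diffContOnCl ?_
      (subset_closure (ball_subset_ball (by linarith) hx))
    intro y hy
    rw [frontier_ball _ (by positivity), mem_sphere_zero_iff_norm] at hy
    have hP : 1 ≤ ‖∏ i ∈ s, (1 - y / (l i : ℂ))‖ := by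
      rw [norm_prod]
      refine Finset.one_le_prod fun i hi => ?_
      have h1 := norm_sub_norm_le (y / (l i : ℂ)) 1
      rw [norm_sub_rev, norm_div, hy, Complex.norm_real, Real.norm_of_nonneg (hpos i).le,
        norm_one] at h1
      have h2 : 2 ≤ 2 * R / l i := by
        rw [le_div_iff₀ (hpos i)]
        linarith [(hsR i).mp hi]
      linarith
    calc ‖h y‖ ≤ ‖∏ i ∈ s, (1 - y / (l i : ℂ))‖ * ‖h y‖ :=
          le_mul_of_one_le_left (norm_nonneg _) hP
      _ = ‖H y‖ := by rw [he, norm_mul]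
      _ ≤ C * Real.exp (ε / 32 * ‖y‖) := hC y
      _ = Real.exp M := by rw [hM, hy, Real.exp_add, Real.exp_log (by linarith)]
  have key := norm_logDeriv_le_of_norm_le_exp hR0 hM0 hd.differentiableOn hh0 hne hb hwR
  have hPw : ∏ i ∈ s, (1 - w / (l i : ℂ)) ≠ 0 := fun h1 => hw (by rw [he, h1, zero_mul])
  have hhw : h w ≠ 0 := fun h1 => hw (by rw [he, h1, mul_zero])
  have hlw : ∀ i ∈ s, (l i : ℂ) ≠ w := fun i _ h1 => hw (h1 ▸ hz' i)
  have hsum : logDeriv H w + ∑ i ∈ s, 1 / ((l i : ℂ) - w) = logDeriv h w := by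
    rw [show H = fun w => (∏ i ∈ s, (1 - w / (l i : ℂ))) * h w from funext he,
      logDeriv_mul w hPw hhw (hPd w) (hd w), logDeriv_prod_one_sub_div hl0 s hlw]
    ring
  rw [hsum]
  refine key.trans ?_
  rw [div_le_iff₀ hR0, hM]
  have h1 : 16 * Real.log C ≤ ε * R := by
    rw [mul_comm ε, ← div_le_iff₀ hε]
    linarith
  linarith

open Topology in
/-- **Mittag-Leffler expansion** of the logarithmic derivative of an entire function of growth
`exp (o (‖w‖))` having only simple positive zeros. -/
theorem hasSum_one_div_sub_of_zeros {H : ℂ → ℂ} (hH : Differentiable ℂ H) (h0 : H 0 = 1)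
    (hg : ∀ ε : ℝ, 0 < ε → ∃ C : ℝ, ∀ w, ‖H w‖ ≤ C * Real.exp (ε * ‖w‖)) {ι : Type*} {l : ι → ℝ}
    (hl : Function.Injective l) (hpos : ∀ i, 0 < l i)
    (hz : ∀ w, H w = 0 ↔ ∃ i, (l i : ℂ) = w) (hs : ∀ i, deriv H (l i) ≠ 0)
    {w : ℂ} (hw : H w ≠ 0) :
    HasSum (fun i => 1 / ((l i : ℂ) - w)) (-logDeriv H w) := by
  have hz' : ∀ i, H (l i) = 0 := fun i => (hz _).mpr ⟨i, rfl⟩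
  have hfin := finite_setOf_le_of_zeros hH (by simp [h0]) hl hpos hz'
  set S : ℝ → Finset ι := fun R => (hfin R).toFinset with hS
  have hSmem : ∀ R i, i ∈ S R ↔ l i ≤ R := fun R i => by simp [hS]
  have happ := fun {ε : ℝ} (hε : 0 < ε) =>
    exists_norm_logDeriv_add_sum_le hH h0 hg hl hpos hz hs hε
  have hsum : Summable fun i => 1 / l i := by
    obtain ⟨R₀, hR₀⟩ := happ one_pos
    refine summable_of_sum_le (c := 1 + ‖logDeriv H 0‖)
      (fun i => (one_div_pos.mpr (hpos i)).le) fun u => ?_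
    obtain ⟨B, hB⟩ := (u.image l).exists_le
    set R := max (max R₀ B) 0
    have h1 := hR₀ R ((le_max_left _ _).trans (le_max_left _ _)) (S R) (hSmem R) 0 (by simp [h0])
      (by rw [norm_zero]; exact div_nonneg (le_max_right _ _) (by norm_num))
    have h2 : ∑ i ∈ u, 1 / l i ≤ ∑ i ∈ S R, 1 / l i := by
      refine Finset.sum_le_sum_of_subset_of_nonneg (fun i hi => (hSmem R i).mpr ?_)
        fun i _ _ => (one_div_pos.mpr (hpos i)).le
      exact (hB _ (Finset.mem_image_of_mem l hi)).trans
        ((le_max_right _ _).trans (le_max_left _ _))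
    have h3 : ∑ i ∈ S R, 1 / ((l i : ℂ) - 0) = ((∑ i ∈ S R, 1 / l i : ℝ) : ℂ) := by
      push_cast
      simp
    have h4 := norm_sub_le (logDeriv H 0 + ∑ i ∈ S R, 1 / ((l i : ℂ) - 0)) (logDeriv H 0)
    rw [add_sub_cancel_left] at h4
    have h5 := Complex.re_le_norm (∑ i ∈ S R, 1 / ((l i : ℂ) - 0))
    rw [h3, Complex.ofReal_re, ← h3] at h5
    linarith
  have hsummable : Summable fun i => 1 / ((l i : ℂ) - w) := by
    refine Summable.of_norm_bounded_eventually (hsum.mul_left 2) ?_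
    have : ∀ᶠ i in cofinite, ¬ l i ≤ 2 * ‖w‖ := hfin (2 * ‖w‖) |>.eventually_cofinite_notMem
    filter_upwards [this] with i hi
    rw [not_le] at hi
    have h1 := norm_sub_norm_le (l i : ℂ) w
    rw [Complex.norm_real, Real.norm_of_nonneg (hpos i).le] at h1
    rw [norm_div, norm_one, ← div_eq_mul_one_div, div_le_div_iff₀ (by linarith [norm_nonneg w])
      (hpos i)]
    linarith
  have htend : Tendsto (fun R => ∑ i ∈ S R, 1 / ((l i : ℂ) - w)) atTop
      (𝓝 (∑' i, 1 / ((l i : ℂ) - w))) :=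
    hsummable.hasSum.comp (tendsto_atTop_finset_of_monotone
      (fun a b hab i hi => (hSmem b i).mpr (((hSmem a i).mp hi).trans hab))
      fun i => ⟨l i, (hSmem _ i).mpr le_rfl⟩)
  have htend2 : Tendsto (fun R => ∑ i ∈ S R, 1 / ((l i : ℂ) - w)) atTop
      (𝓝 (-logDeriv H w)) := by
    rw [Metric.tendsto_nhds]
    intro ε hε
    obtain ⟨R₀, hR₀⟩ := happ (half_pos hε)
    filter_upwards [eventually_ge_atTop R₀, eventually_ge_atTop (4 * ‖w‖)] with R h1 h2
    rw [dist_eq_norm, sub_neg_eq_add, add_comm]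
    exact (hR₀ R h1 (S R) (hSmem R) w hw (by linarith)).trans_lt (half_lt_self hε)
  rw [← tendsto_nhds_unique htend htend2]
  exact hsummable.hasSum

open Topology in
/-- If `(t ^ (ν + 1) * g t)' = t ^ ν * q t` where `q` has nonnegative real part on `(0, 1)` and
positive real part at `0`, then `g 1` has positive real part. -/
theorem re_pos_of_weighted_deriv_nonneg {ν : ℝ} (hν : -1 < ν) {g g' : ℝ → ℂ}
    (hg : ∀ t, HasDerivAt g (g' t) t) {q : ℝ → ℂ} (hq : Continuous q) (hq0 : 0 < (q 0).re)
    (hqn : ∀ t ∈ Ioo (0 : ℝ) 1, 0 ≤ (q t).re) (he : ∀ t, (ν + 1) * g t + t * g' t = q t) :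
    0 < (g 1).re := by
  set W : ℝ → ℝ := fun t => t ^ (ν + 1) * (g t).re with hW
  have hgre : ∀ t, HasDerivAt (fun t => (g t).re) (g' t).re t := fun t =>
    (Complex.reCLM.hasFDerivAt (x := g t)).comp_hasDerivAt t (hg t)
  have hder : ∀ t : ℝ, 0 < t → HasDerivAt W (t ^ ν * (q t).re) t := by
    intro t ht
    have h1 := Real.hasDerivAt_rpow_const (x := t) (p := ν + 1) (Or.inl ht.ne')
    refine (h1.mul (hgre t)).congr_deriv ?_
    have h2 := congrArg Complex.re (he t)
    simp only [Complex.add_re, Complex.mul_re, Complex.ofReal_re, Complex.ofReal_im, Complex.one_re,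
      Complex.add_im, Complex.one_im, zero_mul, sub_zero, add_zero] at h2
    rw [← h2, add_sub_cancel_right, Real.rpow_add_one ht.ne']
    ring
  have hcont : Continuous W := by
    have h1 : Continuous fun t : ℝ => t ^ (ν + 1) :=
      Real.continuous_rpow_const (by linarith)
    have h2 : Continuous fun t => (g t).re :=
      continuous_iff_continuousAt.mpr fun t => (hgre t).continuousAt
    exact h1.mul h2
  have hev : ∀ᶠ t in 𝓝 (0 : ℝ), 0 < (q t).re :=
    (Complex.continuous_re.comp hq).continuousAt.eventually_const_lt hq0
  obtain ⟨δ, hδ, hball⟩ := Metric.eventually_nhds_iff.mp hev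
  set d := min (δ / 2) (1 / 2)
  have hd0 : 0 < d := by positivity
  have hd1 : d ≤ 1 / 2 := min_le_right _ _
  have hdδ : d < δ := (min_le_left _ _).trans_lt (half_lt_self hδ)
  have h1 : W 0 < W d := by
    refine strictMonoOn_of_deriv_pos (convex_Icc 0 d) hcont.continuousOn (fun t ht => ?_)
      (left_mem_Icc.mpr hd0.le) (right_mem_Icc.mpr hd0.le) hd0
    rw [interior_Icc] at ht
    rw [(hder t ht.1).deriv]
    refine mul_pos (Real.rpow_pos_of_pos ht.1 _) (hball ?_)
    rw [Real.dist_eq, sub_zero, abs_of_pos ht.1]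
    exact ht.2.trans hdδ
  have h2 : W d ≤ W 1 := by
    have hint : interior (Icc (0 : ℝ) 1) = Ioo 0 1 := interior_Icc
    refine monotoneOn_of_deriv_nonneg (convex_Icc 0 1) hcont.continuousOn ?_ ?_
      ⟨hd0.le, by linarith⟩ (right_mem_Icc.mpr zero_le_one) (by linarith)
    · rw [hint]
      exact fun t ht => (hder t ht.1).differentiableAt.differentiableWithinAt
    · rw [hint]
      intro t ht
      rw [(hder t ht.1).deriv]
      exact mul_nonneg (Real.rpow_pos_of_pos ht.1 _).le (hqn t ht)
  simp only [hW, Real.zero_rpow (by linarith : ν + 1 ≠ 0), zero_mul, Real.one_rpow, one_mul]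
    at h1 h2
  exact h1.trans_le h2

/-- A solution of `4 w F'' + 4 (ν + 1) F' + F = 0` that is real on the real axis, together with its
derivatives. -/
structure IsRealBesselSolution (ν : ℝ) (F F₁ F₂ : ℂ → ℂ) : Prop where
  hasDerivAt : ∀ w, HasDerivAt F (F₁ w) w
  hasDerivAt' : ∀ w, HasDerivAt F₁ (F₂ w) w
  ode : ∀ w, 4 * w * F₂ w + 4 * (ν + 1) * F₁ w + F w = 0
  map_zero : F 0 = 1
  map_conj : ∀ w, F (starRingEnd ℂ w) = starRingEnd ℂ (F w)
  map_conj' : ∀ w, F₁ (starRingEnd ℂ w) = starRingEnd ℂ (F₁ w)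

namespace IsRealBesselSolution

variable {ν : ℝ} {F F₁ F₂ : ℂ → ℂ}

theorem hasDerivAt_ray {f f₁ : ℂ → ℂ} (hf : ∀ w, HasDerivAt f (f₁ w) w) (a : ℂ) (t : ℝ) :
    HasDerivAt (fun t : ℝ => f (a * t)) (f₁ (a * t) * a) t := by
  have h1 : HasDerivAt (fun t : ℝ => a * (t : ℂ)) a t := by
    simpa using (Complex.ofRealCLM.hasDerivAt (x := t)).const_mul a
  exact (hf (a * t)).comp t h1

theorem continuous_ray (hF : IsRealBesselSolution ν F F₁ F₂) (a : ℂ) :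
    Continuous fun t : ℝ => F (a * t) :=
  continuous_iff_continuousAt.mpr fun t => (hasDerivAt_ray hF.hasDerivAt a t).continuousAt

theorem continuous_ray' (hF : IsRealBesselSolution ν F F₁ F₂) (a : ℂ) :
    Continuous fun t : ℝ => F₁ (a * t) :=
  continuous_iff_continuousAt.mpr fun t => (hasDerivAt_ray hF.hasDerivAt' a t).continuousAt

/-- Green's identity for `conj u * u'` with `u t = F (a t)`, multiplied by a constant `k`. -/
theorem re_pos_of_re_nonneg (hF : IsRealBesselSolution ν F F₁ F₂) (hν : -1 < ν) (a k : ℂ)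
    (h0 : 0 < (-(k * a)).re) (hk : 0 ≤ k.re) :
    0 < (k * (starRingEnd ℂ (F a) * (a * F₁ a))).re := by
  have hconj : ∀ t : ℝ, starRingEnd ℂ a * t = starRingEnd ℂ (a * t) := fun t => by simp
  have key := re_pos_of_weighted_deriv_nonneg hν
    (g := fun t => k * (F (starRingEnd ℂ a * t) * (a * F₁ (a * t))))
    (q := fun t => k * t * (Complex.normSq (a * F₁ (a * t)) : ℂ) +
      (-(k * a) / 4) * (Complex.normSq (F (a * t)) : ℂ))
    (fun t => ((hasDerivAt_ray hF.hasDerivAt (starRingEnd ℂ a) t).mul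
      ((hasDerivAt_ray hF.hasDerivAt' a t).const_mul a)).const_mul k) ?_ ?_ ?_ ?_
  · simpa [hF.map_conj] using key
  · have h1 := hF.continuous_ray a
    have h2 := hF.continuous_ray' a
    exact ((continuous_const.mul Complex.continuous_ofReal).mul (Complex.continuous_ofReal.comp
      (Complex.continuous_normSq.comp (continuous_const.mul h2)))).add
      (continuous_const.mul (Complex.continuous_ofReal.comp (Complex.continuous_normSq.comp h1)))
  · have h1 : (-(k * a) / 4).re = (-(k * a)).re / 4 := by simp
    simp only [Complex.ofReal_zero, mul_zero, zero_mul, zero_add, hF.map_zero, map_one,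
      Complex.ofReal_one, mul_one, h1]
    linarith
  · intro t ht
    have h1 : (k * t * (Complex.normSq (a * F₁ (a * t)) : ℂ)).re =
        k.re * (t * Complex.normSq (a * F₁ (a * t))) := by
      rw [mul_assoc, ← Complex.ofReal_mul, Complex.re_mul_ofReal]
    have h2 : (-(k * a) / 4 * (Complex.normSq (F (a * t)) : ℂ)).re =
        (-(k * a)).re / 4 * Complex.normSq (F (a * t)) := by
      rw [Complex.re_mul_ofReal]
      simp
    rw [Complex.add_re, h1, h2]
    exact add_nonneg (mul_nonneg hk (mul_nonneg ht.1.le (Complex.normSq_nonneg _)))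
      (mul_nonneg (by linarith) (Complex.normSq_nonneg _))
  · intro t
    have h1 := hF.ode (a * t)
    rw [Complex.normSq_eq_conj_mul_self, Complex.normSq_eq_conj_mul_self, hconj, hF.map_conj,
      hF.map_conj', map_mul (starRingEnd ℂ) a (F₁ _)]
    linear_combination k * a / 4 * starRingEnd ℂ (F (a * t)) * h1

/-- All zeros of `F + 2 w F'` are positive reals. -/
theorem exists_pos_of_zero (hF : IsRealBesselSolution ν F F₁ F₂) (hν : -1 < ν) {a : ℂ}
    (ha : F a + 2 * a * F₁ a = 0) : ∃ x : ℝ, 0 < x ∧ (x : ℂ) = a := by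
  have hW : starRingEnd ℂ (F a) * (a * F₁ a) = ((-Complex.normSq (F a) / 2 : ℝ) : ℂ) := by
    push_cast
    rw [Complex.normSq_eq_conj_mul_self]
    linear_combination starRingEnd ℂ (F a) / 2 * ha
  have him : a.im = 0 := by
    by_contra him
    have := hF.re_pos_of_re_nonneg hν a (Complex.I * a.im) (by
      simpa using mul_self_pos.mpr him) (by simp)
    rw [hW, Complex.re_mul_ofReal] at this
    simp at this
  refine ⟨a.re, ?_, Complex.ext rfl (by simp [him])⟩
  by_contra! hre
  rcases hre.lt_or_eq with h | h
  · have := hF.re_pos_of_re_nonneg hν a 1 (by simpa using h) (by simp)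
    rw [hW, one_mul, Complex.ofReal_re] at this
    linarith [Complex.normSq_nonneg (F a)]
  · rw [show a = 0 from Complex.ext h him] at ha
    simp [hF.map_zero] at ha

/-- The positive zeros of `F + 2 w F'` are simple. -/
theorem deriv_ne_zero_of_zero (hF : IsRealBesselSolution ν F F₁ F₂) (hν : -1 < ν) {x : ℝ}
    (hx : F x + 2 * x * F₁ x = 0) : 3 * F₁ x + 2 * x * F₂ x ≠ 0 := by
  intro hx'
  have hreal : ∀ t : ℝ, (F ((x : ℂ) * t)).im = 0 := fun t => by
    rw [← Complex.conj_eq_iff_im, ← hF.map_conj]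
    simp
  have hd : ∀ t : ℝ, HasDerivAt (fun t : ℝ => (t : ℂ)) 1 t := fun t =>
    Complex.ofRealCLM.hasDerivAt (x := t)
  have key := re_pos_of_weighted_deriv_nonneg hν
    (g := fun t => F (x * t) * (ν * F₁ (x * t) + (1 / 4) * F (x * t)) +
      x * t * (F₁ (x * t) * F₁ (x * t)))
    (q := fun t => (1 / 4) * (F (x * t) * F (x * t)))
    (fun t =>
      ((hasDerivAt_ray hF.hasDerivAt (x : ℂ) t).mul
        (((hasDerivAt_ray hF.hasDerivAt' (x : ℂ) t).const_mul (ν : ℂ)).add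
          ((hasDerivAt_ray hF.hasDerivAt (x : ℂ) t).const_mul (1 / 4)))).add
      (((hd t).const_mul (x : ℂ)).mul ((hasDerivAt_ray hF.hasDerivAt' (x : ℂ) t).mul
        (hasDerivAt_ray hF.hasDerivAt' (x : ℂ) t)))) ?_ ?_ ?_ ?_
  · have h1 := hF.ode x
    have h2 : F x * (ν * F₁ x + (1 / 4) * F x) + x * (F₁ x * F₁ x) = 0 := by
      linear_combination (F x / 4) * h1 + (-(F x) / 2) * hx' + F₁ x / 2 * hx
    simp only [Complex.ofReal_one, mul_one, h2, Complex.zero_re, lt_irrefl] at key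
  · have h1 := hF.continuous_ray x
    exact continuous_const.mul (h1.mul h1)
  · simp [hF.map_zero]
  · intro t _
    simpa [hreal t] using mul_self_nonneg _
  · intro t
    simp only [Pi.add_apply]
    linear_combination
      (F (x * t) * ν / 4 + x * t * F₁ (x * t) / 2) * hF.ode (x * t)

end IsRealBesselSolution

/-- The sum of the power series with real coefficients `c`. -/
noncomputable def realPowerSeries (c : ℕ → ℝ) (w : ℂ) : ℂ :=
  ∑' n, (c n : ℂ) * w ^ n

/-- The coefficients of the derivative of a power series. -/
def derivCoeff (c : ℕ → ℝ) (n : ℕ) : ℝ :=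
  (n + 1) * c (n + 1)

/-- Coefficients whose exponential generating rescaling `c n * n!` still gives an entire series. -/
def IsSubexponential (c : ℕ → ℝ) : Prop :=
  ∀ r : ℝ, 0 < r → Summable fun n => |c n| * n.factorial * r ^ n

namespace IsSubexponential

variable {c : ℕ → ℝ}

theorem derivCoeff (hc : IsSubexponential c) : IsSubexponential (derivCoeff c) := by
  intro r hr
  refine (((summable_nat_add_iff 1).mpr (hc r hr)).mul_left r⁻¹).congr fun n => ?_
  rw [_root_.derivCoeff, abs_mul, abs_of_nonneg (by positivity : (0 : ℝ) ≤ n + 1),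
    Nat.factorial_succ, pow_succ]
  push_cast
  field_simp

theorem summable_abs (hc : IsSubexponential c) {r : ℝ} (hr : 0 < r) :
    Summable fun n => |c n| * r ^ n := by
  refine (hc r hr).of_nonneg_of_le (fun n => by positivity) fun n => ?_
  have : (1 : ℝ) ≤ n.factorial := by exact_mod_cast n.factorial_pos
  gcongr
  exact le_mul_of_one_le_right (abs_nonneg _) this

theorem norm_term_le (c : ℕ → ℝ) {r : ℝ} (n : ℕ) {w : ℂ} (hw : ‖w‖ ≤ r) :
    ‖(c n : ℂ) * w ^ n‖ ≤ |c n| * r ^ n := by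
  rw [norm_mul, norm_pow, Complex.norm_real, Real.norm_eq_abs]
  gcongr

theorem hasSum (hc : IsSubexponential c) (w : ℂ) :
    HasSum (fun n => (c n : ℂ) * w ^ n) (realPowerSeries c w) :=
  (Summable.of_norm_bounded (hc.summable_abs (r := ‖w‖ + 1) (by positivity))
    fun n => norm_term_le c n (by linarith)).hasSum

theorem hasDerivAt (hc : IsSubexponential c) (w : ℂ) :
    HasDerivAt (realPowerSeries c) (realPowerSeries (_root_.derivCoeff c) w) w := by
  have hr : 0 < ‖w‖ + 1 := by positivity
  have hu := hc.summable_abs hr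
  have hd : ∀ n, DifferentiableOn ℂ (fun w : ℂ => (c n : ℂ) * w ^ n) (Metric.ball 0 (‖w‖ + 1)) :=
    fun n => by fun_prop
  have hle : ∀ (n : ℕ) (x : ℂ), x ∈ Metric.ball (0 : ℂ) (‖w‖ + 1) →
      ‖(c n : ℂ) * x ^ n‖ ≤ |c n| * (‖w‖ + 1) ^ n := fun n x hx =>
    norm_term_le c n (by rw [mem_ball_zero_iff] at hx; exact hx.le)
  have hw : w ∈ Metric.ball (0 : ℂ) (‖w‖ + 1) := by simp
  have h1 := (Complex.differentiableOn_tsum_of_summable_norm hu hd Metric.isOpen_ball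
    hle).differentiableAt (Metric.isOpen_ball.mem_nhds hw)
  have h2 := Complex.hasSum_deriv_of_summable_norm hu hd Metric.isOpen_ball hle hw
  have h3 : HasSum (fun n => deriv (fun w : ℂ => (c n : ℂ) * w ^ n) w)
      (realPowerSeries (_root_.derivCoeff c) w) := by
    rw [← hasSum_nat_add_iff' 1]
    simp only [Finset.range_one, Finset.sum_singleton, pow_zero, mul_one, deriv_const, sub_zero]
    refine (hc.derivCoeff.hasSum w).congr_fun fun n => ?_
    simp [_root_.derivCoeff]
    ring
  exact h1.hasDerivAt.congr_deriv (h2.unique h3)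

theorem exists_norm_le_exp (hc : IsSubexponential c) {ε : ℝ} (hε : 0 < ε) :
    ∃ C : ℝ, 0 ≤ C ∧ ∀ w, ‖realPowerSeries c w‖ ≤ C * Real.exp (ε * ‖w‖) := by
  have hs := hc ε⁻¹ (inv_pos.mpr hε)
  refine ⟨∑' n, |c n| * n.factorial * ε⁻¹ ^ n, tsum_nonneg fun n => by positivity, fun w => ?_⟩
  have hexp : HasSum (fun n : ℕ => (ε * ‖w‖) ^ n / n.factorial) (Real.exp (ε * ‖w‖)) := by
    rw [Real.exp_eq_exp_ℝ]
    exact NormedSpace.expSeries_div_hasSum_exp _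
  refine tsum_of_norm_bounded (hexp.mul_left _) fun n => ?_
  refine (norm_term_le c n le_rfl).trans ?_
  calc |c n| * ‖w‖ ^ n = |c n| * n.factorial * ε⁻¹ ^ n * ((ε * ‖w‖) ^ n / n.factorial) := by
        rw [mul_pow, inv_pow]
        field_simp
    _ ≤ _ := by
        gcongr
        exact hs.le_tsum n fun m _ => by positivity

end IsSubexponential

theorem realPowerSeries_conj (c : ℕ → ℝ) (w : ℂ) :
    realPowerSeries c (starRingEnd ℂ w) = starRingEnd ℂ (realPowerSeries c w) := by
  rw [realPowerSeries, realPowerSeries, Complex.conj_tsum]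
  simp

theorem realPowerSeries_zero (c : ℕ → ℝ) : realPowerSeries c 0 = c 0 := by
  rw [realPowerSeries, tsum_eq_single 0 fun n hn => by simp [hn]]
  simp

/-- The coefficients of the entire function `Γ(ν + 1) (√w / 2) ^ (-ν) J_ν(√w)` of `w`. -/
noncomputable def besselCoeff (ν : ℝ) (n : ℕ) : ℝ :=
  (-1) ^ n * Real.Gamma (ν + 1) / (4 ^ n * n.factorial * Real.Gamma (n + ν + 1))

section besselCoeff

variable {ν : ℝ}

theorem gamma_natCast_add_pos (hν : -1 < ν) (n : ℕ) : 0 < Real.Gamma (n + ν + 1) :=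
  Real.Gamma_pos_of_pos (by have : (0 : ℝ) ≤ n := n.cast_nonneg; linarith)

theorem besselCoeff_zero (hν : -1 < ν) : besselCoeff ν 0 = 1 := by
  have := (Real.Gamma_pos_of_pos (by linarith : 0 < ν + 1)).ne'
  simp [besselCoeff, this]

theorem besselCoeff_ne_zero (hν : -1 < ν) (n : ℕ) : besselCoeff ν n ≠ 0 := by
  have h1 := (gamma_natCast_add_pos hν n).ne'
  have h2 := (Real.Gamma_pos_of_pos (by linarith : 0 < ν + 1)).ne'
  unfold besselCoeff
  positivity

theorem besselCoeff_succ (hν : -1 < ν) (n : ℕ) :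
    4 * (n + 1) * (n + ν + 1) * besselCoeff ν (n + 1) = -besselCoeff ν n := by
  have h0 : (0 : ℝ) ≤ n := n.cast_nonneg
  have h1 := (gamma_natCast_add_pos hν n).ne'
  have h2 : (n : ℝ) + ν + 1 ≠ 0 := by linarith
  have h3 : ((n + 1 : ℕ) : ℝ) + ν + 1 = n + ν + 1 + 1 := by push_cast; ring
  rw [besselCoeff, besselCoeff, h3, Real.Gamma_add_one h2, Nat.factorial_succ]
  push_cast
  field_simp
  ring

theorem isSubexponential_besselCoeff (hν : -1 < ν) : IsSubexponential (besselCoeff ν) := by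
  intro r hr
  refine summable_of_ratio_test_tendsto_lt_one zero_lt_one
    (Eventually.of_forall fun n => ?_) ?_
  · have := besselCoeff_ne_zero hν n
    positivity
  · have hlim : Tendsto (fun n : ℕ => r / 4 / ((n : ℝ) + (ν + 1))) atTop (nhds 0) :=
      tendsto_const_nhds.div_atTop
        (tendsto_atTop_add_const_right _ _ tendsto_natCast_atTop_atTop)
    refine hlim.congr fun n => ?_
    have h0 : (0 : ℝ) ≤ n := n.cast_nonneg
    have h1 : 0 < (n : ℝ) + ν + 1 := by linarith
    have h2 := abs_pos.mpr (besselCoeff_ne_zero hν n)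
    have h3 : 4 * (n + 1) * (n + ν + 1) * |besselCoeff ν (n + 1)| = |besselCoeff ν n| := by
      have := congrArg abs (besselCoeff_succ hν n)
      rwa [abs_neg, abs_mul, abs_of_pos (by positivity)] at this
    rw [Real.norm_of_nonneg (by positivity), Real.norm_of_nonneg (by positivity), ← add_assoc,
      ← h3, Nat.factorial_succ, pow_succ]
    have h4 := abs_pos.mpr (besselCoeff_ne_zero hν (n + 1))
    push_cast
    field_simp

theorem derivCoeff_besselCoeff (hν : -1 < ν) (n : ℕ) :
    besselCoeff (ν + 1) n = -(4 * (ν + 1)) * derivCoeff (besselCoeff ν) n := by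
  have h1 := (gamma_natCast_add_pos (by linarith : -1 < ν + 1) n).ne'
  have h2 : ν + 1 ≠ 0 := by linarith
  have h3 : ((n + 1 : ℕ) : ℝ) + ν + 1 = n + (ν + 1) + 1 := by push_cast; ring
  rw [derivCoeff, besselCoeff, besselCoeff, h3, Real.Gamma_add_one h2, Nat.factorial_succ]
  push_cast
  field_simp
  ring

theorem isRealBesselSolution_realPowerSeries (hν : -1 < ν) :
    IsRealBesselSolution ν (realPowerSeries (besselCoeff ν))
      (realPowerSeries (derivCoeff (besselCoeff ν)))
      (realPowerSeries (derivCoeff (derivCoeff (besselCoeff ν)))) where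
  hasDerivAt := (isSubexponential_besselCoeff hν).hasDerivAt
  hasDerivAt' := (isSubexponential_besselCoeff hν).derivCoeff.hasDerivAt
  map_zero := by simp [realPowerSeries_zero, besselCoeff_zero hν]
  map_conj := realPowerSeries_conj _
  map_conj' := realPowerSeries_conj _
  ode w := by
    have hc := isSubexponential_besselCoeff hν
    have h1 := (hc.derivCoeff.derivCoeff.hasSum w).mul_left (4 * w)
    have h2 : HasSum (fun n : ℕ => 4 * (n : ℂ) * (derivCoeff (besselCoeff ν) n : ℂ) * w ^ n)
        (4 * w * realPowerSeries (derivCoeff (derivCoeff (besselCoeff ν))) w) := by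
      rw [← hasSum_nat_add_iff' 1]
      simp only [Finset.range_one, Finset.sum_singleton, Nat.cast_zero, mul_zero, zero_mul,
        sub_zero]
      refine h1.congr_fun fun n => ?_
      rw [derivCoeff.eq_def (derivCoeff _)]
      push_cast
      ring
    have h3 := (hc.derivCoeff.hasSum w).mul_left (4 * ((ν : ℂ) + 1))
    refine ((h2.add h3).add (hc.hasSum w)).unique ?_
    refine hasSum_zero.congr_fun fun n => ?_
    have h4 := congrArg (fun x : ℝ => (x : ℂ)) (besselCoeff_succ hν n)
    push_cast at h4
    rw [derivCoeff]
    push_cast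
    linear_combination w ^ n * h4

end besselCoeff

/-- The entire function `H` with `g_ν'(z) = H(z ^ 2)`. -/
noncomputable def diniEntire (ν : ℝ) (w : ℂ) : ℂ :=
  realPowerSeries (besselCoeff ν) w + 2 * w * realPowerSeries (derivCoeff (besselCoeff ν)) w

section diniEntire

variable {ν : ℝ}

theorem hasDerivAt_diniEntire (hν : -1 < ν) (w : ℂ) :
    HasDerivAt (diniEntire ν) (3 * realPowerSeries (derivCoeff (besselCoeff ν)) w +
      2 * w * realPowerSeries (derivCoeff (derivCoeff (besselCoeff ν))) w) w := by
  have hF := isRealBesselSolution_realPowerSeries hν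
  refine ((hF.hasDerivAt w).add
    (((hasDerivAt_id w).const_mul 2).mul (hF.hasDerivAt' w))).congr_deriv ?_
  simp only [id]
  ring

theorem diniEntire_zero (hν : -1 < ν) : diniEntire ν 0 = 1 := by
  simp [diniEntire, (isRealBesselSolution_realPowerSeries hν).map_zero]

theorem exists_norm_diniEntire_le (hν : -1 < ν) {ε : ℝ} (hε : 0 < ε) :
    ∃ C : ℝ, ∀ w, ‖diniEntire ν w‖ ≤ C * Real.exp (ε * ‖w‖) := by
  have hc := isSubexponential_besselCoeff hν
  obtain ⟨A, hA0, hA⟩ := hc.exists_norm_le_exp hε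
  obtain ⟨B, hB0, hB⟩ := hc.derivCoeff.exists_norm_le_exp (half_pos hε)
  refine ⟨A + 4 / ε * B, fun w => ?_⟩
  have h1 : 2 * ‖w‖ ≤ 4 / ε * Real.exp (ε / 2 * ‖w‖) := by
    have := Real.add_one_le_exp (ε / 2 * ‖w‖)
    calc 2 * ‖w‖ = 4 / ε * (ε / 2 * ‖w‖) := by field_simp; ring
      _ ≤ _ := by gcongr; linarith
  have h2 : Real.exp (ε * ‖w‖) = Real.exp (ε / 2 * ‖w‖) * Real.exp (ε / 2 * ‖w‖) := by
    rw [← Real.exp_add]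
    ring_nf
  calc ‖diniEntire ν w‖ ≤ A * Real.exp (ε * ‖w‖) +
        (4 / ε * Real.exp (ε / 2 * ‖w‖)) * (B * Real.exp (ε / 2 * ‖w‖)) := by
        refine (norm_add_le _ _).trans (add_le_add (hA w) ?_)
        rw [norm_mul, norm_mul, Complex.norm_ofNat]
        exact mul_le_mul h1 (hB w) (norm_nonneg _) (by positivity)
    _ = _ := by rw [h2]; ring

theorem besselJC_eq (hν : -1 < ν) {z : ℂ} (hz : z ≠ 0) :
    2 ^ (ν : ℂ) * Complex.Gamma ((ν : ℂ) + 1) * z ^ (-(ν : ℂ)) * besselJC ν z =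
      realPowerSeries (besselCoeff ν) (z ^ 2) := by
  rw [besselJC, realPowerSeries, ← tsum_mul_left]
  refine tsum_congr fun n => ?_
  have hΓ : Complex.Gamma ((n : ℂ) + ν + 1) = (Real.Gamma (n + ν + 1) : ℂ) := by
    rw [← Complex.Gamma_ofReal]; push_cast; rfl
  have hΓ0 : Complex.Gamma ((ν : ℂ) + 1) = (Real.Gamma (ν + 1) : ℂ) := by
    rw [← Complex.Gamma_ofReal]; push_cast; rfl
  have hΓn : (Real.Gamma (n + ν + 1) : ℂ) ≠ 0 := by
    exact_mod_cast (gamma_natCast_add_pos hν n).ne'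
  have h2n : (2 * (n : ℂ)) = ((2 * n : ℕ) : ℂ) := by push_cast; rfl
  have hp2 : (2 : ℂ) ^ (ν : ℂ) ≠ 0 := by simp [Complex.cpow_eq_zero_iff]
  have hpz : z ^ (ν : ℂ) ≠ 0 := by simp [Complex.cpow_eq_zero_iff, hz]
  rw [hΓ, hΓ0, Complex.cpow_add _ _ hz, Complex.cpow_add _ _ two_ne_zero, Complex.cpow_neg, h2n,
    Complex.cpow_natCast, Complex.cpow_natCast, pow_mul, pow_mul, besselCoeff]
  push_cast
  field_simp
  norm_num

theorem gderivC_eq (hν : -1 < ν) {z : ℂ} (hz : z ≠ 0) : gderivC ν z = diniEntire ν (z ^ 2) := by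
  have h1 := besselJC_eq hν hz
  have h2 := besselJC_eq (by linarith : -1 < ν + 1) hz
  have h3 : realPowerSeries (besselCoeff (ν + 1)) (z ^ 2) =
      -(4 * (ν + 1)) * realPowerSeries (derivCoeff (besselCoeff ν)) (z ^ 2) := by
    rw [realPowerSeries, realPowerSeries, ← tsum_mul_left]
    refine tsum_congr fun n => ?_
    rw [derivCoeff_besselCoeff hν]
    push_cast
    ring
  have hν0 : (ν : ℂ) + 1 ≠ 0 := by
    exact_mod_cast (by linarith : ν + 1 ≠ 0)
  rw [h3] at h2
  push_cast at h2
  rw [Complex.Gamma_add_one _ hν0, Complex.cpow_add _ _ two_ne_zero, Complex.cpow_one, neg_add,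
    Complex.cpow_add _ _ hz, Complex.cpow_neg_one] at h2
  have h4 : 2 ^ (ν : ℂ) * Complex.Gamma ((ν : ℂ) + 1) * z ^ (-(ν : ℂ)) *
      (z * besselJC (ν + 1) z) =
      -2 * z ^ 2 * realPowerSeries (derivCoeff (besselCoeff ν)) (z ^ 2) := by
    field_simp at h2
    refine mul_left_cancel₀ (mul_ne_zero two_ne_zero hz) ?_
    linear_combination z ^ 2 * h2
  rw [gderivC, diniC, mul_sub, h1, h4, diniEntire]
  ring

theorem diniC_eq_zero_iff (hν : -1 < ν) {z : ℂ} (hz : z ≠ 0) :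
    diniC ν z = 0 ↔ diniEntire ν (z ^ 2) = 0 := by
  rw [← gderivC_eq hν hz, gderivC]
  have hΓ : Complex.Gamma ((ν : ℂ) + 1) ≠ 0 := by
    have h1 : Complex.Gamma ((ν : ℂ) + 1) = (Real.Gamma (ν + 1) : ℂ) := by
      rw [← Complex.Gamma_ofReal]; push_cast; rfl
    rw [h1]
    exact_mod_cast (Real.Gamma_pos_of_pos (by linarith : 0 < ν + 1)).ne'
  simp [Complex.cpow_eq_zero_iff, hz, hΓ]

theorem eventually_gderivC_eq (hν : -1 < ν) {z : ℂ} (hz : gderivC ν z ≠ 0) :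
    gderivC ν =ᶠ[nhds z] fun z => diniEntire ν (z ^ 2) := by
  rcases ne_or_eq z 0 with h | rfl
  · filter_upwards [isOpen_ne.mem_nhds h] with x hx using gderivC_eq hν hx
  · have hν0 : ν = 0 := by
      by_contra h
      exact hz (by simp [gderivC, h])
    subst hν0
    refine Eventually.of_forall fun x => ?_
    rcases ne_or_eq x 0 with h | rfl
    · exact gderivC_eq hν h
    · have h1 : besselJC 0 0 = 1 := by
        rw [besselJC, tsum_eq_single 0 fun n hn => by
          rw [Complex.zero_cpow (by simpa using hn)]
          simp]
        simp
      simp [gderivC, diniC, h1, diniEntire_zero hν]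

end diniEntire

/-- Let `ν > -1` and let `α 1 < α 2 < ⋯` be the strictly increasing
enumeration of the positive zeros of the Dini function `d_ν` (with `α 0 = 0`). Then for
every complex `z` which is not a zero of `g_ν'` one has the Mittag-Leffler expansion
`g_ν''(z) / g_ν'(z) = -∑_{n ≥ 1} 2 z / (α_n² - z²)`. -/
theorem dini_mittag_leffler (ν : ℝ) (hν : -1 < ν) (α : ℕ → ℝ)
    (hα0 : α 0 = 0) (hmono : StrictMono α)
    (hzeros : ∀ x : ℝ, (0 < x ∧ diniC ν (x : ℂ) = 0) ↔ ∃ n, 1 ≤ n ∧ α n = x)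
    (z : ℂ) (hz : gderivC ν z ≠ 0) :
    deriv (gderivC ν) z / gderivC ν z =
      -∑' n : ℕ, 2 * z / ((α (n + 1) : ℂ) ^ 2 - z ^ 2) := by
  have hF := isRealBesselSolution_realPowerSeries hν
  have hpos : ∀ n, 0 < α (n + 1) := fun n => hα0 ▸ hmono n.succ_pos
  have hH : Differentiable ℂ (diniEntire ν) := fun w =>
    (hasDerivAt_diniEntire hν w).differentiableAt
  have hzeros' : ∀ w, diniEntire ν w = 0 ↔ ∃ n, ((α (n + 1) ^ 2 : ℝ) : ℂ) = w := by
    intro w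
    constructor
    · intro hw
      obtain ⟨x, hx, rfl⟩ := hF.exists_pos_of_zero hν hw
      have hsq : ((√x : ℝ) : ℂ) ^ 2 = x := by
        rw [← Complex.ofReal_pow, Real.sq_sqrt hx.le]
      have hne : ((√x : ℝ) : ℂ) ≠ 0 := by exact_mod_cast (Real.sqrt_pos.mpr hx).ne'
      obtain ⟨n, hn, hnx⟩ := (hzeros √x).mp
        ⟨Real.sqrt_pos.mpr hx, (diniC_eq_zero_iff hν hne).mpr (by rw [hsq, hw])⟩
      refine ⟨n - 1, ?_⟩
      rw [Nat.sub_add_cancel hn, hnx, Real.sq_sqrt hx.le]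
    · rintro ⟨n, rfl⟩
      have hne : (α (n + 1) : ℂ) ≠ 0 := by exact_mod_cast (hpos n).ne'
      rw [Complex.ofReal_pow, ← diniC_eq_zero_iff hν hne]
      exact ((hzeros _).mpr ⟨n + 1, n.succ_pos, rfl⟩).2
  have hinj : Function.Injective fun n => α (n + 1) ^ 2 := fun m n hmn => by
    have := hmono.injective ((sq_eq_sq₀ (hpos m).le (hpos n).le).mp hmn)
    omega
  have hev := eventually_gderivC_eq hν hz
  have hval : gderivC ν z = diniEntire ν (z ^ 2) := hev.eq_of_nhds
  have hsum := hasSum_one_div_sub_of_zeros hH (diniEntire_zero hν)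
    (fun ε hε => exists_norm_diniEntire_le hν hε) hinj (fun n => pow_pos (hpos n) 2) hzeros'
    (fun n => by
      rw [(hasDerivAt_diniEntire hν _).deriv]
      exact hF.deriv_ne_zero_of_zero hν ((hzeros' _).mpr ⟨n, rfl⟩))
    (hval ▸ hz)
  have hderiv : deriv (gderivC ν) z = deriv (diniEntire ν) (z ^ 2) * (2 * z) := by
    rw [hev.deriv_eq]
    have h1 : HasDerivAt (fun z : ℂ => z ^ 2) (2 * z) z := by
      simpa using hasDerivAt_pow 2 z
    exact ((hH (z ^ 2)).hasDerivAt.comp z h1).deriv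
  have htsum := (hsum.mul_left (2 * z)).tsum_eq
  simp only [Complex.ofReal_pow, mul_one_div] at htsum
  rw [htsum, hderiv, hval, logDeriv_apply]
  ring
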